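/- arXiv:2102.04243 — 9 statements merged into one kernel-verified Lean document; each statement's English description precedes it below -/
import Mathlib

section
/- The function ψ is strictly convex on ℝ; in particular its second derivative satisfies ψ''(x) > 0 for every x ∈ ℝ, so ψ' is strictly increasing. -/
open Real MeasureTheory

/-- The integrand of the parabolic cylinder integral is integrable on `(0, ∞)` for `s > -1`. -/
theorem integrableOn_rpow_mul_exp_neg_sq_add_mul {s : ℝ} (hs : -1 < s) (y : ℝ) :
    IntegrableOn (fun t : ℝ => t ^ s * Real.exp (-t ^ 2 / 2 + y * t)) (Set.Ioi 0) := by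
  have h := (integrableOn_rpow_mul_exp_neg_mul_sq (b := 1 / 4) (by norm_num) hs).const_mul
    (Real.exp (y ^ 2))
  refine Integrable.mono' h (by fun_prop) ?_
  filter_upwards [ae_restrict_mem measurableSet_Ioi] with t ht
  have ht' : 0 ≤ t ^ s := Real.rpow_nonneg (le_of_lt ht) s
  rw [Real.norm_of_nonneg (by positivity)]
  calc t ^ s * Real.exp (-t ^ 2 / 2 + y * t)
      ≤ t ^ s * Real.exp (y ^ 2 + -(1 / 4) * t ^ 2) := by
        refine mul_le_mul_of_nonneg_left (Real.exp_le_exp.2 ?_) ht'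
        nlinarith [sq_nonneg (t / 2 - y)]
    _ = Real.exp (y ^ 2) * (t ^ s * Real.exp (-(1 / 4) * t ^ 2)) := by
        rw [Real.exp_add]; ring

theorem integral_rpow_mul_exp_neg_sq_add_mul_pos {s : ℝ} (hs : -1 < s) (y : ℝ) :
    0 < ∫ t in Set.Ioi (0 : ℝ), t ^ s * Real.exp (-t ^ 2 / 2 + y * t) := by
  have hpos : ∀ t ∈ Set.Ioi (0 : ℝ), 0 < t ^ s * Real.exp (-t ^ 2 / 2 + y * t) :=
    fun t ht => mul_pos (Real.rpow_pos_of_pos ht s) (Real.exp_pos _)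
  rw [setIntegral_pos_iff_support_of_nonneg_ae
    (by filter_upwards [ae_restrict_mem measurableSet_Ioi] with t ht using (hpos t ht).le)
    (integrableOn_rpow_mul_exp_neg_sq_add_mul hs y),
    Set.inter_eq_self_of_subset_right fun t ht => Function.mem_support.2 (hpos t ht).ne']
  simp

/-- Differentiating under the integral sign raises the exponent by one. -/
theorem hasDerivAt_integral_rpow_mul_exp_neg_sq_add_mul {s : ℝ} (hs : -1 < s) (y : ℝ) :
    HasDerivAt (fun y : ℝ => ∫ t in Set.Ioi (0 : ℝ), t ^ s * Real.exp (-t ^ 2 / 2 + y * t))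
      (∫ t in Set.Ioi (0 : ℝ), t ^ (s + 1) * Real.exp (-t ^ 2 / 2 + y * t)) y := by
  refine (hasDerivAt_integral_of_dominated_loc_of_deriv_le
    (F' := fun y t => t ^ (s + 1) * Real.exp (-t ^ 2 / 2 + y * t))
    (bound := fun t => t ^ (s + 1) * Real.exp (-t ^ 2 / 2 + (y + 1) * t))
    (Iio_mem_nhds (lt_add_one y))
    (Filter.Eventually.of_forall fun z =>
      (integrableOn_rpow_mul_exp_neg_sq_add_mul hs z).aestronglyMeasurable)
    (integrableOn_rpow_mul_exp_neg_sq_add_mul hs y)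
    (integrableOn_rpow_mul_exp_neg_sq_add_mul (by linarith) y).aestronglyMeasurable
    ?_ (integrableOn_rpow_mul_exp_neg_sq_add_mul (by linarith) (y + 1)) ?_).2
  · filter_upwards [ae_restrict_mem measurableSet_Ioi] with t ht z hz
    have ht₀ : 0 < t := ht
    have hz' : z ≤ y + 1 := le_of_lt hz
    rw [Real.norm_of_nonneg (by positivity)]
    gcongr
  · filter_upwards [ae_restrict_mem measurableSet_Ioi] with t ht z _
    have ht₀ : 0 < t := ht
    have h := ((((hasDerivAt_id z).mul_const t).const_add (-t ^ 2 / 2)).exp).const_mul (t ^ s)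
    refine h.congr_deriv ?_
    rw [Real.rpow_add_one ht₀.ne']
    simp only [id]
    ring

/-- `ψ` is strictly convex on `ℝ`; in particular `ψ'' > 0` everywhere,
so `ψ'` is strictly increasing. -/
theorem psi_strictConvex
    (κ σ ρ ζ : ℝ) (hκ : 0 < κ) (hσ : 0 < σ) (hρ : 0 < ρ)
    (ψ : ℝ → ℝ)
    (hψ : ∀ x : ℝ, ψ x = (Real.Gamma (ρ / κ))⁻¹ *
      ∫ t in Set.Ioi (0 : ℝ), t ^ (ρ / κ - 1) *
        Real.exp (-t ^ 2 / 2 + ((x - ζ) * Real.sqrt (2 * κ) / σ) * t)) :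
    StrictConvexOn ℝ Set.univ ψ ∧
    (∀ x : ℝ, 0 < iteratedDeriv 2 ψ x) ∧
    StrictMono (deriv ψ) := by
  have hs : -1 < ρ / κ - 1 := by linarith [div_pos hρ hκ]
  set s := ρ / κ - 1
  have hc : 0 < (Real.Gamma (ρ / κ))⁻¹ := inv_pos.2 (Real.Gamma_pos_of_pos (div_pos hρ hκ))
  set c := (Real.Gamma (ρ / κ))⁻¹
  have hk : 0 < Real.sqrt (2 * κ) / σ := by positivity
  set k := Real.sqrt (2 * κ) / σ with hk_def
  let G : ℝ → ℝ → ℝ := fun r y =>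
    ∫ t in Set.Ioi (0 : ℝ), t ^ r * Real.exp (-t ^ 2 / 2 + y * t)
  have hψG : ψ = fun x => c * G s ((x - ζ) * k) := by
    funext x
    rw [hψ, hk_def, ← mul_div_assoc]
  have hG : ∀ r : ℝ, -1 < r → ∀ x : ℝ,
      HasDerivAt (fun x => G r ((x - ζ) * k)) (G (r + 1) ((x - ζ) * k) * k) x := by
    intro r hr x
    have h := ((hasDerivAt_id x).sub_const ζ).mul_const k
    rw [one_mul] at h
    exact (hasDerivAt_integral_rpow_mul_exp_neg_sq_add_mul hr ((x - ζ) * k)).comp x h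
  have hd : deriv ψ = fun x => c * (G (s + 1) ((x - ζ) * k) * k) := by
    rw [hψG]
    exact funext fun x => ((hG s hs x).const_mul c).deriv
  have hdd : deriv (deriv ψ) = fun x => c * (G (s + 1 + 1) ((x - ζ) * k) * k * k) := by
    rw [hd]
    exact funext fun x => (((hG (s + 1) (by linarith) x).mul_const k).const_mul c).deriv
  have hpos : ∀ x, 0 < deriv (deriv ψ) x := by
    intro x
    have hG_pos : 0 < G (s + 1 + 1) ((x - ζ) * k) :=
      integral_rpow_mul_exp_neg_sq_add_mul_pos (by linarith) _
    rw [hdd]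
    positivity
  have hcont : Continuous ψ := by
    rw [hψG]
    exact continuous_iff_continuousAt.2 fun x => ((hG s hs x).const_mul c).continuousAt
  have hmono : StrictMono (deriv ψ) := strictMono_of_deriv_pos hpos
  refine ⟨hmono.strictConvexOn_univ_of_deriv hcont, fun x => ?_, hmono⟩
  rw [iteratedDeriv_succ, iteratedDeriv_one]
  exact hpos x
end

section
/- For every k ∈ ℕ, the k-th derivative ψ^(k) of ψ solves the ordinary differential equation (σ²/2)(ψ^(k))''(x) + κ(ζ−x)(ψ^(k))'(x) − (ρ + kκ)ψ^(k)(x) = 0 for every x ∈ ℝ; that is, ψ^(k) is (up to a multiplicative constant) the strictly increasing fundamental solution of Lu − (ρ + kκ)u = 0. -/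
open Real MeasureTheory

/-- The integral `∫₀^∞ t^(a-1) exp(-t²/2 + z t) dt`, which is proportional to the product of a
Gaussian factor and a parabolic cylinder function. -/
noncomputable def gaussianMellin (a z : ℝ) : ℝ :=
  ∫ t in Set.Ioi (0 : ℝ), t ^ (a - 1) * Real.exp (-t ^ 2 / 2 + z * t)

lemma gaussianMellin_integrand_le (a : ℝ) {z M t : ℝ} (hz : |z| ≤ M) (ht : 0 < t) :
    t ^ (a - 1) * Real.exp (-t ^ 2 / 2 + z * t) ≤
      Real.exp (M ^ 2) * (t ^ (a - 1) * Real.exp (-(1 / 4) * t ^ 2)) := by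
  have hzM : z ≤ M := (le_abs_self z).trans hz
  calc t ^ (a - 1) * Real.exp (-t ^ 2 / 2 + z * t)
      ≤ t ^ (a - 1) * Real.exp (M ^ 2 + -(1 / 4) * t ^ 2) := by
        have hexp : -t ^ 2 / 2 + z * t ≤ M ^ 2 + -(1 / 4) * t ^ 2 := by
          nlinarith [sq_nonneg (M - t / 2), mul_le_mul_of_nonneg_right hzM ht.le]
        exact mul_le_mul_of_nonneg_left (Real.exp_le_exp.2 hexp) (by positivity)
    _ = _ := by rw [Real.exp_add]; ring

lemma continuousOn_gaussianMellin_integrand (a z : ℝ) :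
    ContinuousOn (fun t : ℝ => t ^ (a - 1) * Real.exp (-t ^ 2 / 2 + z * t)) (Set.Ioi 0) := by
  refine ContinuousOn.mul (fun t ht => ?_) (by fun_prop)
  exact (Real.continuousAt_rpow_const t _ (Or.inl (ne_of_gt ht))).continuousWithinAt

lemma integrableOn_gaussianMellin_bound {a : ℝ} (ha : 0 < a) (M : ℝ) :
    IntegrableOn (fun t : ℝ => Real.exp (M ^ 2) * (t ^ (a - 1) * Real.exp (-(1 / 4) * t ^ 2)))
      (Set.Ioi 0) :=
  (integrableOn_rpow_mul_exp_neg_mul_sq (by norm_num) (by linarith)).const_mul _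

lemma integrableOn_gaussianMellin_integrand {a : ℝ} (ha : 0 < a) (z : ℝ) :
    IntegrableOn (fun t : ℝ => t ^ (a - 1) * Real.exp (-t ^ 2 / 2 + z * t)) (Set.Ioi 0) := by
  refine (integrableOn_gaussianMellin_bound ha |z|).mono'
    ((continuousOn_gaussianMellin_integrand a z).aestronglyMeasurable measurableSet_Ioi) ?_
  filter_upwards [ae_restrict_mem measurableSet_Ioi] with t ht
  have ht' : 0 < t := ht
  rw [Real.norm_of_nonneg (by positivity)]
  exact gaussianMellin_integrand_le a le_rfl ht'

lemma gaussianMellin_pos {a : ℝ} (ha : 0 < a) (z : ℝ) : 0 < gaussianMellin a z := by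
  have hpos : ∀ t ∈ Set.Ioi (0 : ℝ), 0 < t ^ (a - 1) * Real.exp (-t ^ 2 / 2 + z * t) :=
    fun t ht => mul_pos (Real.rpow_pos_of_pos ht _) (Real.exp_pos _)
  refine (setIntegral_pos_iff_support_of_nonneg_ae ?_
    (integrableOn_gaussianMellin_integrand ha z)).2 ?_
  · filter_upwards [ae_restrict_mem measurableSet_Ioi] with t ht using (hpos t ht).le
  · rw [Set.inter_eq_right.2 fun t ht => Function.mem_support.2 (hpos t ht).ne']
    simp

lemma hasDerivAt_gaussianMellin {a : ℝ} (ha : 0 < a) (z : ℝ) :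
    HasDerivAt (gaussianMellin a) (gaussianMellin (a + 1) z) z := by
  refine (hasDerivAt_integral_of_dominated_loc_of_deriv_le
    (μ := volume.restrict (Set.Ioi (0 : ℝ)))
    (F := fun z t => t ^ (a - 1) * Real.exp (-t ^ 2 / 2 + z * t))
    (F' := fun z t => t ^ (a + 1 - 1) * Real.exp (-t ^ 2 / 2 + z * t))
    (Metric.ball_mem_nhds z one_pos)
    (Filter.Eventually.of_forall fun y =>
      (continuousOn_gaussianMellin_integrand a y).aestronglyMeasurable measurableSet_Ioi)
    (integrableOn_gaussianMellin_integrand ha z)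
    ((continuousOn_gaussianMellin_integrand (a + 1) z).aestronglyMeasurable measurableSet_Ioi)
    ?_ (integrableOn_gaussianMellin_bound (add_pos ha one_pos) (|z| + 1)) ?_).2
  · filter_upwards [ae_restrict_mem measurableSet_Ioi] with t ht y hy
    have ht' : 0 < t := ht
    rw [Real.norm_of_nonneg (by positivity)]
    refine gaussianMellin_integrand_le _ ?_ ht'
    rw [Metric.mem_ball, Real.dist_eq] at hy
    linarith [abs_sub_abs_le_abs_sub y z]
  · filter_upwards [ae_restrict_mem measurableSet_Ioi] with t ht y _
    refine (((((hasDerivAt_id y).mul_const t).const_add (-t ^ 2 / 2)).exp).const_mul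
      (t ^ (a - 1))).congr_deriv ?_
    rw [add_sub_right_comm, Real.rpow_add_one (ne_of_gt ht)]
    simp only [id]
    ring

lemma gaussianMellin_add_two {a : ℝ} (ha : 0 < a) (z : ℝ) :
    gaussianMellin (a + 2) z = z * gaussianMellin (a + 1) z + a * gaussianMellin a z := by
  have i0 := integrableOn_gaussianMellin_integrand ha z
  have i1 := integrableOn_gaussianMellin_integrand (add_pos ha one_pos) z
  have i2 := integrableOn_gaussianMellin_integrand (add_pos ha two_pos) z
  have hint := ((i0.const_mul a).add (i1.const_mul z)).sub i2
  have hderiv : ∀ t ∈ Set.Ioi (0 : ℝ),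
      HasDerivAt (fun t : ℝ => t ^ (a + 1 - 1) * Real.exp (-t ^ 2 / 2 + z * t))
        (a * (t ^ (a - 1) * Real.exp (-t ^ 2 / 2 + z * t))
          + z * (t ^ (a + 1 - 1) * Real.exp (-t ^ 2 / 2 + z * t))
          - t ^ (a + 2 - 1) * Real.exp (-t ^ 2 / 2 + z * t)) t := by
    intro t ht
    have ht' : t ≠ 0 := ne_of_gt ht
    have hexp : HasDerivAt (fun t : ℝ => -t ^ 2 / 2 + z * t) (-t + z) t := by
      refine (((hasDerivAt_pow 2 t).neg.div_const 2).add
        ((hasDerivAt_id t).const_mul z)).congr_deriv ?_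
      push_cast
      ring
    refine ((Real.hasDerivAt_rpow_const (p := a + 1 - 1) (Or.inl ht')).mul
      hexp.exp).congr_deriv ?_
    rw [show a + 2 - 1 = a + 1 by ring, Real.rpow_add_one ht', add_sub_cancel_right]
    ring
  have hcont : ContinuousWithinAt
      (fun t : ℝ => t ^ (a + 1 - 1) * Real.exp (-t ^ 2 / 2 + z * t)) (Set.Ici 0) 0 := by
    refine ((Real.continuousAt_rpow_const 0 _ (Or.inr (by simpa using ha.le))).mul
      (by fun_prop)).continuousWithinAt
  have h := integral_Ioi_of_hasDerivAt_of_tendsto hcont hderiv hint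
    (tendsto_zero_of_hasDerivAt_of_integrableOn_Ioi hderiv hint i1)
  have hsub := integral_sub ((i0.const_mul a).add (i1.const_mul z)) i2
  have hadd := integral_add (i0.const_mul a) (i1.const_mul z)
  simp only [Pi.add_apply] at hsub
  rw [hsub, hadd, integral_const_mul, integral_const_mul] at h
  simp only [add_sub_cancel_right, Real.zero_rpow ha.ne', zero_mul, sub_zero] at h
  simp only [gaussianMellin, add_sub_cancel_right]
  linarith

lemma hasDerivAt_gaussianMellin_comp_affine {a : ℝ} (ha : 0 < a) (c b ζ x : ℝ) :
    HasDerivAt (fun x => c * gaussianMellin a (b * (x - ζ)))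
      (c * b * gaussianMellin (a + 1) (b * (x - ζ))) x := by
  have hin : HasDerivAt (fun x => b * (x - ζ)) b x := by
    simpa using ((hasDerivAt_id x).sub_const ζ).const_mul b
  exact (((hasDerivAt_gaussianMellin ha _).comp x hin).const_mul c).congr_deriv (by ring)

lemma iteratedDeriv_gaussianMellin_comp_affine {a : ℝ} (ha : 0 < a) (c b ζ : ℝ) (k : ℕ) :
    iteratedDeriv k (fun x => c * gaussianMellin a (b * (x - ζ))) =
      fun x => c * b ^ k * gaussianMellin (a + k) (b * (x - ζ)) := by
  induction k with
  | zero => simp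
  | succ k ih =>
    rw [iteratedDeriv_succ, ih]
    funext x
    rw [(hasDerivAt_gaussianMellin_comp_affine (by positivity) _ b ζ x).deriv]
    push_cast
    rw [pow_succ, ← mul_assoc, add_assoc]

/-- For every `k`, the `k`-th derivative of `ψ` solves
`(σ²/2)u'' + κ(ζ−x)u' − (ρ + kκ)u = 0` and is strictly increasing. -/
theorem psi_iteratedDeriv_solves_ode
    (κ σ ρ ζ : ℝ) (hκ : 0 < κ) (hσ : 0 < σ) (hρ : 0 < ρ)
    (ψ : ℝ → ℝ)
    (hψ : ∀ x : ℝ, ψ x = (Real.Gamma (ρ / κ))⁻¹ *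
      ∫ t in Set.Ioi (0 : ℝ), t ^ (ρ / κ - 1) *
        Real.exp (-t ^ 2 / 2 + ((x - ζ) * Real.sqrt (2 * κ) / σ) * t)) :
    ∀ k : ℕ,
      (∀ x : ℝ,
        σ ^ 2 / 2 * iteratedDeriv 2 (iteratedDeriv k ψ) x
          + κ * (ζ - x) * deriv (iteratedDeriv k ψ) x
          - (ρ + k * κ) * iteratedDeriv k ψ x = 0) ∧
      StrictMono (iteratedDeriv k ψ) := by
  have hb : 0 < Real.sqrt (2 * κ) / σ := by positivity
  have hb2 : σ ^ 2 * (Real.sqrt (2 * κ) / σ) ^ 2 = 2 * κ := by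
    rw [div_pow, Real.sq_sqrt (by positivity)]
    field_simp
  set b := Real.sqrt (2 * κ) / σ
  set a := ρ / κ
  have ha : 0 < a := div_pos hρ hκ
  have haκ : a * κ = ρ := div_mul_cancel₀ ρ hκ.ne'
  have hc : 0 < (Real.Gamma a)⁻¹ := inv_pos.2 (Real.Gamma_pos_of_pos ha)
  have hψ' : ψ = fun x => (Real.Gamma a)⁻¹ * gaussianMellin a (b * (x - ζ)) := by
    funext x
    rw [hψ x, gaussianMellin]
    rw [mul_div_assoc, mul_comm (x - ζ)]
  intro k
  have hak : 0 < a + k := by positivity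
  rw [hψ', iteratedDeriv_gaussianMellin_comp_affine ha]
  refine ⟨fun x => ?_, strictMono_of_deriv_pos fun x => ?_⟩
  · rw [iteratedDeriv_gaussianMellin_comp_affine hak,
      (hasDerivAt_gaussianMellin_comp_affine hak _ b ζ x).deriv]
    push_cast
    rw [gaussianMellin_add_two hak, ← haκ]
    linear_combination ((Real.Gamma a)⁻¹ * b ^ k / 2 *
      (b * (x - ζ) * gaussianMellin (a + k + 1) (b * (x - ζ)) +
        (a + k) * gaussianMellin (a + k) (b * (x - ζ)))) * hb2
  · rw [(hasDerivAt_gaussianMellin_comp_affine hak _ b ζ x).deriv]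
    have := gaussianMellin_pos (add_pos hak one_pos) (b * (x - ζ))
    positivity
end

section
/- For every k ∈ ℕ and every x ∈ ℝ, the derivatives of ψ satisfy the strict inequality ψ^(k+2)(x)·ψ^(k)(x) − (ψ^(k+1)(x))² > 0. -/
open Real MeasureTheory

/-- An integrable function that is a.e. positive for a nonzero measure has positive integral. -/
lemma integral_pos_of_ae_pos {Ω : Type*} {m : MeasurableSpace Ω} {μ : Measure Ω} (hμ : μ ≠ 0)
    {f : Ω → ℝ} (hf : ∀ᵐ ω ∂μ, 0 < f ω) (hfi : Integrable f μ) : 0 < ∫ ω, f ω ∂μ := by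
  have h0 : 0 ≤ᵐ[μ] f := hf.mono fun ω h ↦ h.le
  refine lt_of_le_of_ne (integral_nonneg_of_ae h0) fun h ↦ hμ ?_
  have hz := (integral_eq_zero_iff_of_nonneg_ae h0 hfi).1 h.symm
  have hF : ∀ᵐ _ ∂μ, False := by
    filter_upwards [hf, hz] with ω h1 h2
    exact h1.ne' h2
  simpa using hF

/-- Strict Turán inequality for the derivatives of the moment generating function of an a.e.
positive, nowhere concentrated function with exponential moments of all orders. -/
lemma iteratedDeriv_mgf_mul_sub_sq_pos {Ω : Type*} {m : MeasurableSpace Ω} {μ : Measure Ω}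
    (hμ : μ ≠ 0) {X : Ω → ℝ} (hX : ∀ᵐ ω ∂μ, 0 < X ω) (hne : ∀ r, ∀ᵐ ω ∂μ, X ω ≠ r)
    (hint : ∀ x, Integrable (fun ω ↦ exp (x * X ω)) μ) (k : ℕ) (x : ℝ) :
    0 < iteratedDeriv (k + 2) (ProbabilityTheory.mgf X μ) x
          * iteratedDeriv k (ProbabilityTheory.mgf X μ) x
        - (iteratedDeriv (k + 1) (ProbabilityTheory.mgf X μ) x) ^ 2 := by
  have hx : x ∈ interior (ProbabilityTheory.integrableExpSet X μ) := by
    have : ProbabilityTheory.integrableExpSet X μ = Set.univ := Set.eq_univ_of_forall hint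
    simp [this]
  have hi (n : ℕ) : Integrable (fun ω ↦ X ω ^ n * exp (x * X ω)) μ :=
    ProbabilityTheory.integrable_pow_mul_exp_of_mem_interior_integrableExpSet hx n
  simp only [ProbabilityTheory.iteratedDeriv_mgf hx]
  set A := ∫ ω, X ω ^ (k + 2) * exp (x * X ω) ∂μ with hA
  set B := ∫ ω, X ω ^ (k + 1) * exp (x * X ω) ∂μ with hB
  set C := ∫ ω, X ω ^ k * exp (x * X ω) ∂μ with hC
  have hCpos : 0 < C := by
    refine integral_pos_of_ae_pos hμ ?_ (hi k)
    filter_upwards [hX] with ω h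
    positivity
  have hdiff : Integrable (fun ω ↦ X ω ^ (k + 2) * exp (x * X ω)
      - 2 * (B / C) * (X ω ^ (k + 1) * exp (x * X ω))) μ :=
    (hi _).sub ((hi _).const_mul _)
  have hsum : Integrable (fun ω ↦ X ω ^ (k + 2) * exp (x * X ω)
      - 2 * (B / C) * (X ω ^ (k + 1) * exp (x * X ω))
      + (B / C) ^ 2 * (X ω ^ k * exp (x * X ω))) μ :=
    hdiff.add ((hi _).const_mul _)
  have hpos := integral_pos_of_ae_pos hμ (by
    filter_upwards [hX, hne (B / C)] with ω h1 h2
    have h3 : 0 < (X ω - B / C) ^ 2 := by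
      have := sub_ne_zero.2 h2
      positivity
    have h4 : 0 < X ω ^ k * exp (x * X ω) * (X ω - B / C) ^ 2 := by positivity
    linear_combination h4) hsum
  rw [integral_add hdiff ((hi _).const_mul _),
    integral_sub (hi _) ((hi _).const_mul _), integral_const_mul, integral_const_mul,
    ← hA, ← hB, ← hC] at hpos
  have h := mul_pos hpos hCpos
  have e : (A - 2 * (B / C) * B + (B / C) ^ 2 * C) * C = A * C - B ^ 2 := by
    field_simp
    ring
  rwa [e] at h

lemma integrableOn_rpow_mul_exp_neg_sq_add {a : ℝ} (ha : 0 < a) (b : ℝ) :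
    IntegrableOn (fun t : ℝ ↦ t ^ (a - 1) * exp (-t ^ 2 / 2 + b * t)) (Set.Ioi 0) := by
  have h := (integrableOn_rpow_mul_exp_neg_mul_sq (b := 1 / 4) (by norm_num)
    (s := a - 1) (by linarith)).const_mul (exp (b ^ 2))
  refine Integrable.mono' h (by fun_prop) ?_
  filter_upwards [ae_restrict_mem measurableSet_Ioi] with t ht
  have ht0 : (0 : ℝ) < t := ht
  rw [norm_of_nonneg (by positivity), mul_left_comm, ← exp_add]
  refine mul_le_mul_of_nonneg_left (exp_le_exp.2 ?_) (by positivity)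
  nlinarith [sq_nonneg (t - 2 * b)]

/-- For every `k` and `x`, `ψ⁽ᵏ⁺²⁾(x)·ψ⁽ᵏ⁾(x) − (ψ⁽ᵏ⁺¹⁾(x))² > 0`. -/
theorem psi_derivatives_inequality
    (κ σ ρ ζ : ℝ) (hκ : 0 < κ) (hσ : 0 < σ) (hρ : 0 < ρ)
    (ψ : ℝ → ℝ)
    (hψ : ∀ x : ℝ, ψ x = (Real.Gamma (ρ / κ))⁻¹ *
      ∫ t in Set.Ioi (0 : ℝ), t ^ (ρ / κ - 1) *
        Real.exp (-t ^ 2 / 2 + ((x - ζ) * Real.sqrt (2 * κ) / σ) * t)) :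
    ∀ (k : ℕ) (x : ℝ),
      0 < iteratedDeriv (k + 2) ψ x * iteratedDeriv k ψ x
            - (iteratedDeriv (k + 1) ψ x) ^ 2 := by
  have ha : 0 < ρ / κ := by positivity
  have hG : 0 < Real.Gamma (ρ / κ) := Real.Gamma_pos_of_pos ha
  set a := ρ / κ
  set c := Real.sqrt (2 * κ) / σ with hc
  have hcpos : 0 < c := by positivity
  set w : ℝ → ℝ := fun t ↦ (Real.Gamma a)⁻¹ * (t ^ (a - 1) * exp (-t ^ 2 / 2 - ζ * c * t)) with hw
  have hwm : Measurable w := by fun_prop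
  have hwpos : ∀ᵐ t ∂volume.restrict (Set.Ioi (0 : ℝ)), 0 < w t := by
    filter_upwards [ae_restrict_mem measurableSet_Ioi] with t ht
    have ht0 : (0 : ℝ) < t := ht
    positivity
  set μ : Measure ℝ := (volume.restrict (Set.Ioi (0 : ℝ))).withDensity
    (fun t ↦ ENNReal.ofReal (w t)) with hμdef
  have hac : μ ≪ volume.restrict (Set.Ioi (0 : ℝ)) := withDensity_absolutelyContinuous _ _
  have hμ : μ ≠ 0 := by
    intro h
    have h1 := (withDensity_eq_zero_iff (by fun_prop)).1 h
    have h2 : ∀ᵐ _ ∂volume.restrict (Set.Ioi (0 : ℝ)), False := by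
      filter_upwards [hwpos, h1] with t h3 h4
      simp at h4
      linarith
    rw [Filter.eventually_false_iff_eq_bot, ae_eq_bot, Measure.restrict_eq_zero] at h2
    simp at h2
  have hexp (x t : ℝ) : w t * exp (x * (c * t)) = (Real.Gamma a)⁻¹ *
      (t ^ (a - 1) * exp (-t ^ 2 / 2 + ((x - ζ) * Real.sqrt (2 * κ) / σ) * t)) := by
    simp only [hw, mul_assoc, ← exp_add]
    congr 3
    rw [hc]
    ring
  have htoReal (x : ℝ) : (fun t ↦ (ENNReal.ofReal (w t)).toReal * exp (x * (c * t)))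
      =ᵐ[volume.restrict (Set.Ioi (0 : ℝ))] fun t ↦ (Real.Gamma a)⁻¹ *
      (t ^ (a - 1) * exp (-t ^ 2 / 2 + ((x - ζ) * Real.sqrt (2 * κ) / σ) * t)) := by
    filter_upwards [hwpos] with t ht
    rw [ENNReal.toReal_ofReal ht.le, hexp]
  have hψ_eq : ψ = ProbabilityTheory.mgf (fun t ↦ c * t) μ := by
    ext x
    rw [hψ, ProbabilityTheory.mgf, hμdef, integral_withDensity_eq_integral_toReal_smul
      (by fun_prop) (by simp)]
    simp only [smul_eq_mul]
    rw [integral_congr_ae (htoReal x), integral_const_mul]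
  rw [hψ_eq]
  refine iteratedDeriv_mgf_mul_sub_sq_pos hμ (hac.ae_le ?_) (fun r ↦ hac.ae_le ?_) fun x ↦ ?_
  · filter_upwards [ae_restrict_mem measurableSet_Ioi] with t ht
    exact mul_pos hcpos ht
  · filter_upwards [Measure.ae_ne (volume.restrict (Set.Ioi (0 : ℝ))) (r / c)] with t ht h
    exact ht (by rw [← h]; field_simp)
  · rw [hμdef, integrable_withDensity_iff_integrable_smul' (by fun_prop) (by simp)]
    simp only [smul_eq_mul]
    rw [integrable_congr (htoReal x)]
    exact (integrableOn_rpow_mul_exp_neg_sq_add ha _).const_mul _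
end

section
/- The function H is strictly decreasing on ℝ; in particular H'(x) = (ψ(x)/ψ'(x))' − 1 < 0 for every x ∈ ℝ. -/
open Real MeasureTheory

/-- The moment integral `∫₀^∞ t ^ p * exp (-t ^ 2 / 2 + a * t) dt`. -/
noncomputable def gaussianMoment (p a : ℝ) : ℝ :=
  ∫ t in Set.Ioi (0 : ℝ), t ^ p * Real.exp (-t ^ 2 / 2 + a * t)

theorem integrableOn_gaussianMoment {p : ℝ} (hp : -1 < p) (a : ℝ) :
    IntegrableOn (fun t : ℝ => t ^ p * Real.exp (-t ^ 2 / 2 + a * t)) (Set.Ioi 0) := by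
  have hdom : IntegrableOn (fun t : ℝ => Real.exp (a ^ 2) *
      (t ^ p * Real.exp (-(1 / 4) * t ^ 2))) (Set.Ioi 0) :=
    (integrableOn_rpow_mul_exp_neg_mul_sq (by norm_num) hp).const_mul _
  refine hdom.mono' (by fun_prop) ?_
  filter_upwards [ae_restrict_mem measurableSet_Ioi] with t ht
  have ht : 0 < t := ht
  have hpow : 0 ≤ t ^ p := by positivity
  rw [Real.norm_of_nonneg (by positivity), mul_left_comm, ← Real.exp_add]
  refine mul_le_mul_of_nonneg_left (Real.exp_le_exp.2 ?_) hpow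
  nlinarith [sq_nonneg (t / 2 - a)]

theorem gaussianMoment_pos {p : ℝ} (hp : -1 < p) (a : ℝ) : 0 < gaussianMoment p a := by
  refine (setIntegral_pos_iff_support_of_nonneg_ae ?_ (integrableOn_gaussianMoment hp a)).2 ?_
  · filter_upwards [ae_restrict_mem measurableSet_Ioi] with t ht
    have ht : 0 < t := ht
    simp only [Pi.zero_apply]
    positivity
  · have hsub : Set.Ioi (0 : ℝ) ⊆
        Function.support (fun t : ℝ => t ^ p * Real.exp (-t ^ 2 / 2 + a * t)) := by
      intro t ht
      have ht : 0 < t := ht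
      exact ne_of_gt (by positivity)
    rw [Set.inter_eq_right.2 hsub]
    simp

theorem hasDerivAt_gaussianMoment {p : ℝ} (hp : -1 < p) (a : ℝ) :
    HasDerivAt (gaussianMoment p) (gaussianMoment (p + 1) a) a := by
  refine (hasDerivAt_integral_of_dominated_loc_of_deriv_le
    (F := fun b t : ℝ => t ^ p * Real.exp (-t ^ 2 / 2 + b * t))
    (F' := fun b t : ℝ => t ^ (p + 1) * Real.exp (-t ^ 2 / 2 + b * t))
    (bound := fun t : ℝ => t ^ (p + 1) * Real.exp (-t ^ 2 / 2 + (a + 1) * t))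
    (Metric.ball_mem_nhds a one_pos) (.of_forall fun b => ?_)
    (integrableOn_gaussianMoment hp a) ?_ ?_
    (integrableOn_gaussianMoment (by linarith) (a + 1)) ?_).2
  · exact (integrableOn_gaussianMoment hp b).aestronglyMeasurable
  · exact (integrableOn_gaussianMoment (by linarith) a).aestronglyMeasurable
  · filter_upwards [ae_restrict_mem measurableSet_Ioi] with t ht b hb
    have ht : 0 < t := ht
    have hb : b ≤ a + 1 := by
      rw [Metric.mem_ball, Real.dist_eq] at hb
      linarith [(abs_lt.1 hb).2]
    rw [Real.norm_of_nonneg (by positivity)]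
    gcongr
  · filter_upwards [ae_restrict_mem measurableSet_Ioi] with t ht b _
    have ht : 0 < t := ht
    have hexp : HasDerivAt (fun b : ℝ => -t ^ 2 / 2 + b * t) t b := by
      simpa using ((hasDerivAt_id b).mul_const t).const_add (-t ^ 2 / 2)
    refine (hexp.exp.const_mul (t ^ p)).congr_deriv ?_
    rw [Real.rpow_add_one ht.ne']
    ring

/-- If `f * f'' > 0` and `f' ≠ 0` at a point, then `f / f'` has derivative less than one there. -/
theorem deriv_div_deriv_sub_one_neg {f f' : ℝ → ℝ} {f'' x : ℝ}
    (hf : ∀ y, HasDerivAt f (f' y) y) (hf' : HasDerivAt f' f'' x)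
    (h : f' x ≠ 0) (hpos : 0 < f x * f'') :
    ∃ d, HasDerivAt (fun y => f y / deriv f y) d x ∧ d - 1 < 0 := by
  have hderiv : deriv f = f' := funext fun y => (hf y).deriv
  rw [hderiv]
  refine ⟨_, (hf x).div hf' h, ?_⟩
  have hsq : 0 < f' x ^ 2 := by positivity
  rw [sub_neg, div_lt_one hsq]
  nlinarith

/-- The function `H(x) = c(ρ+κ) − ζκ/ρ + ψ(x)/ψ'(x) − x` is strictly decreasing;
in particular `H'(x) = (ψ/ψ')'(x) − 1 < 0` for every `x`. -/
theorem H_strictAnti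
    (κ σ ρ c ζ : ℝ) (hκ : 0 < κ) (hσ : 0 < σ) (hρ : 0 < ρ) (hc : 0 < c)
    (ψ : ℝ → ℝ)
    (hψ : ∀ x : ℝ, ψ x = (Real.Gamma (ρ / κ))⁻¹ *
      ∫ t in Set.Ioi (0 : ℝ), t ^ (ρ / κ - 1) *
        Real.exp (-t ^ 2 / 2 + ((x - ζ) * Real.sqrt (2 * κ) / σ) * t))
    (H : ℝ → ℝ)
    (hH : ∀ x : ℝ, H x = c * (ρ + κ) - ζ * κ / ρ + ψ x / deriv ψ x - x) :
    StrictAnti H ∧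
    (∀ x : ℝ, deriv (fun y : ℝ => ψ y / deriv ψ y) x - 1 < 0) := by
  have hs : 0 < ρ / κ := div_pos hρ hκ
  have hΓ : 0 < (Real.Gamma (ρ / κ))⁻¹ := inv_pos.2 (Real.Gamma_pos_of_pos hs)
  set C := (Real.Gamma (ρ / κ))⁻¹
  set α := Real.sqrt (2 * κ) / σ with hα_def
  have hα : 0 < α := by positivity
  set p := ρ / κ - 1
  have hp : -1 < p := by simp only [p]; linarith
  have hψ' : ψ = fun x => C * gaussianMoment p ((x - ζ) * α) := by
    funext x
    rw [hψ, hα_def, ← mul_div_assoc, gaussianMoment]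
  have hmoment (q : ℝ) (hq : -1 < q) (x : ℝ) :
      HasDerivAt (fun x => gaussianMoment q ((x - ζ) * α))
        (gaussianMoment (q + 1) ((x - ζ) * α) * α) x := by
    have hlin : HasDerivAt (fun x : ℝ => (x - ζ) * α) α x := by
      simpa using ((hasDerivAt_id x).sub_const ζ).mul_const α
    exact (hasDerivAt_gaussianMoment hq _).comp x hlin
  have hquot (x : ℝ) : ∃ d, HasDerivAt (fun y => ψ y / deriv ψ y) d x ∧ d - 1 < 0 := by
    have h0 := gaussianMoment_pos hp ((x - ζ) * α)
    have h1 := gaussianMoment_pos (show -1 < p + 1 by linarith) ((x - ζ) * α)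
    have h2 := gaussianMoment_pos (show -1 < p + 1 + 1 by linarith) ((x - ζ) * α)
    rw [hψ']
    exact deriv_div_deriv_sub_one_neg (fun y => (hmoment p hp y).const_mul C)
      (((hmoment (p + 1) (by linarith) x).mul_const α).const_mul C)
      (by positivity) (by positivity)
  refine ⟨strictAnti_of_deriv_neg fun x => ?_, fun x => ?_⟩
  · obtain ⟨d, hd, hneg⟩ := hquot x
    have hdH : HasDerivAt (fun y => c * (ρ + κ) - ζ * κ / ρ + ψ y / deriv ψ y - y) (d - 1) x :=
      (hd.const_add _).sub (hasDerivAt_id' x)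
    rwa [funext hH, hdH.deriv]
  · obtain ⟨d, hd, hneg⟩ := hquot x
    rwa [hd.deriv]
end

section
/- There exists a unique solution x̄ ∈ ℝ of the equation H(x) = 0. -/
open Real MeasureTheory

namespace ProbabilityTheory

variable {Ω : Type*} {mΩ : MeasurableSpace Ω} {X : Ω → ℝ} {μ : Measure Ω}

lemma continuous_deriv_cgf (h : integrableExpSet X μ = Set.univ) :
    Continuous (deriv (cgf X μ)) :=
  continuous_iff_continuousAt.2 fun v ↦
    (analyticAt_cgf (X := X) (μ := μ) (v := v) (by simp [h])).deriv.continuousAt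

lemma monotone_deriv_cgf (h : integrableExpSet X μ = Set.univ) :
    Monotone (deriv (cgf X μ)) := by
  refine monotone_of_deriv_nonneg (fun v ↦ ?_) fun v ↦ ?_
  · exact (analyticAt_cgf (X := X) (μ := μ) (v := v) (by simp [h])).deriv.differentiableAt
  · have htwo : deriv (deriv (cgf X μ)) v = iteratedDeriv 2 (cgf X μ) v := by
      rw [iteratedDeriv_succ, iteratedDeriv_one]
    rw [htwo, iteratedDeriv_two_cgf_eq_integral (by simp [h])]
    exact div_nonneg (integral_nonneg fun ω ↦ by positivity) mgf_nonneg

lemma deriv_cgf_pos {v : ℝ} (h : v ∈ interior (integrableExpSet X μ)) (hμ : μ ≠ 0)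
    (hX : ∀ᵐ ω ∂μ, 0 < X ω) : 0 < deriv (cgf X μ) v := by
  rw [deriv_cgf h]
  refine div_pos ?_ (mgf_pos' hμ (interior_subset (s := integrableExpSet X μ) h))
  have hint : Integrable (fun ω ↦ X ω * Real.exp (v * X ω)) μ := by
    simpa using integrable_pow_mul_exp_of_mem_interior_integrableExpSet h 1
  rw [integral_pos_iff_support_of_nonneg_ae _ hint]
  · rw [measure_congr (t := Set.univ)]
    · simpa [pos_iff_ne_zero] using hμ
    · refine Filter.eventuallyEq_univ.2 ?_
      filter_upwards [hX] with ω hω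
      simp [hω.ne']
  · filter_upwards [hX] with ω hω
    exact (mul_pos hω (Real.exp_pos _)).le

end ProbabilityTheory

lemma Antitone.existsUnique_add_sub_eq_zero {q : ℝ → ℝ} (hq : Antitone q) (hcont : Continuous q)
    (C : ℝ) : ∃! x : ℝ, C + q x - x = 0 := by
  have hanti : StrictAnti fun x ↦ C + q x - x := fun x y hxy ↦ by
    have := hq hxy.le
    dsimp only
    linarith
  have hzero : (0 : ℝ) ∈ Set.range fun x ↦ C + q x - x := by
    refine mem_range_of_exists_le_of_exists_ge (by fun_prop)
      ⟨|C + q 0|, ?_⟩ ⟨-|C + q 0|, ?_⟩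
    · have := hq (abs_nonneg (C + q 0))
      have := le_abs_self (C + q 0)
      linarith
    · have := hq (neg_nonpos.2 (abs_nonneg (C + q 0)))
      have := neg_abs_le (C + q 0)
      linarith
  obtain ⟨x, hx⟩ := hzero
  exact ⟨x, hx, fun y hy ↦ hanti.injective (hy.trans hx.symm)⟩

open ProbabilityTheory

/-- The measure `t ^ s * exp (-t ^ 2 / 2) dt` on the positive half-line. -/
noncomputable def rpowGaussianMeasure (s : ℝ) : Measure ℝ :=
  (volume.restrict (Set.Ioi 0)).withDensity
    fun t ↦ ENNReal.ofReal (t ^ s * Real.exp (-t ^ 2 / 2))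

lemma measurable_rpowGaussianDensity (s : ℝ) :
    Measurable fun t : ℝ ↦ ENNReal.ofReal (t ^ s * Real.exp (-t ^ 2 / 2)) := by
  fun_prop

lemma rpowGaussianMeasure_pos (s : ℝ) : ∀ᵐ t ∂rpowGaussianMeasure s, 0 < t :=
  (withDensity_absolutelyContinuous _ _).ae_le (ae_restrict_mem measurableSet_Ioi)

lemma rpowGaussianMeasure_ne_zero (s : ℝ) : rpowGaussianMeasure s ≠ 0 := by
  intro h
  rw [rpowGaussianMeasure,
    withDensity_eq_zero_iff (measurable_rpowGaussianDensity s).aemeasurable] at h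
  have hfalse : ∀ᵐ t ∂volume.restrict (Set.Ioi (0 : ℝ)), False := by
    filter_upwards [h, ae_restrict_mem measurableSet_Ioi] with t ht ht0
    have : 0 < t ^ s * Real.exp (-t ^ 2 / 2) :=
      mul_pos (Real.rpow_pos_of_pos ht0 _) (Real.exp_pos _)
    simp only [Pi.zero_apply, ENNReal.ofReal_eq_zero] at ht
    linarith
  rw [Filter.eventually_false_iff_eq_bot, ae_eq_bot, Measure.restrict_eq_zero,
    Real.volume_Ioi] at hfalse
  exact ENNReal.top_ne_zero hfalse

lemma integrableExpSet_rpowGaussianMeasure {s : ℝ} (hs : -1 < s) :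
    integrableExpSet id (rpowGaussianMeasure s) = Set.univ := by
  refine Set.eq_univ_of_forall fun y ↦ ?_
  change Integrable _ _
  rw [rpowGaussianMeasure, integrable_withDensity_iff_integrable_smul'
    (measurable_rpowGaussianDensity s) (by simp)]
  refine ((integrableOn_rpow_mul_exp_neg_mul_sq (b := 1 / 4) (by norm_num) hs).mul_const
    (Real.exp (y ^ 2))).mono' (by fun_prop) ?_
  filter_upwards [ae_restrict_mem measurableSet_Ioi] with t ht
  have hts : 0 < t ^ s := Real.rpow_pos_of_pos ht _
  rw [ENNReal.toReal_ofReal (by positivity), smul_eq_mul, Real.norm_of_nonneg (by positivity),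
    mul_assoc, mul_assoc, ← Real.exp_add, ← Real.exp_add, id]
  refine mul_le_mul_of_nonneg_left (Real.exp_le_exp.2 ?_) hts.le
  nlinarith [sq_nonneg (t / 2 - y)]

lemma mgf_rpowGaussianMeasure (s y : ℝ) :
    mgf id (rpowGaussianMeasure s) y =
      ∫ t in Set.Ioi (0 : ℝ), t ^ s * Real.exp (-t ^ 2 / 2 + y * t) := by
  rw [mgf, rpowGaussianMeasure, integral_withDensity_eq_integral_toReal_smul
    (measurable_rpowGaussianDensity s) (by simp)]
  refine setIntegral_congr_fun measurableSet_Ioi fun t ht ↦ ?_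
  have hts : 0 < t ^ s := Real.rpow_pos_of_pos ht _
  simp only [id]
  rw [ENNReal.toReal_ofReal (by positivity), smul_eq_mul, mul_assoc, ← Real.exp_add]

/-- There exists a unique solution `x̄ ∈ ℝ` of `H(x) = 0`. -/
theorem H_unique_zero
    (κ σ ρ c ζ : ℝ) (hκ : 0 < κ) (hσ : 0 < σ) (hρ : 0 < ρ) (hc : 0 < c)
    (ψ : ℝ → ℝ)
    (hψ : ∀ x : ℝ, ψ x = (Real.Gamma (ρ / κ))⁻¹ *
      ∫ t in Set.Ioi (0 : ℝ), t ^ (ρ / κ - 1) *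
        Real.exp (-t ^ 2 / 2 + ((x - ζ) * Real.sqrt (2 * κ) / σ) * t))
    (H : ℝ → ℝ)
    (hH : ∀ x : ℝ, H x = c * (ρ + κ) - ζ * κ / ρ + ψ x / deriv ψ x - x) :
    ∃! xbar : ℝ, H xbar = 0 := by
  set μ := rpowGaussianMeasure (ρ / κ - 1)
  set b := √(2 * κ) / σ
  have hb : 0 < b := by positivity
  have hΓ : Real.Gamma (ρ / κ) ≠ 0 := (Real.Gamma_pos_of_pos (by positivity)).ne'
  have huniv : integrableExpSet id μ = Set.univ :=
    integrableExpSet_rpowGaussianMeasure (by linarith [div_pos hρ hκ])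
  have hmem (y : ℝ) : y ∈ interior (integrableExpSet id μ) := by simp [huniv]
  have hderiv_pos (y : ℝ) : 0 < deriv (cgf id μ) y :=
    deriv_cgf_pos (hmem y) (rpowGaussianMeasure_ne_zero _) (rpowGaussianMeasure_pos _)
  have hψ_mgf : ψ = fun x ↦ (Real.Gamma (ρ / κ))⁻¹ * mgf id μ (b * (x - ζ)) := by
    funext x
    rw [hψ, mgf_rpowGaussianMeasure, show (x - ζ) * √(2 * κ) / σ = b * (x - ζ) by ring]
  have hratio (x : ℝ) : ψ x / deriv ψ x = (b * deriv (cgf id μ) (b * (x - ζ)))⁻¹ := by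
    have hlin : HasDerivAt (fun x ↦ b * (x - ζ)) b x := by
      simpa using ((hasDerivAt_id x).sub_const ζ).const_mul b
    have hd := ((hasDerivAt_mgf (hmem (b * (x - ζ)))).comp x hlin).const_mul
      (Real.Gamma (ρ / κ))⁻¹
    rw [hψ_mgf, deriv_cgf (hmem _)]
    erw [hd.deriv]
    field_simp
  have hanti : Antitone fun x ↦ (b * deriv (cgf id μ) (b * (x - ζ)))⁻¹ := fun x y hxy ↦ by
    have := hderiv_pos (b * (x - ζ))
    dsimp only
    gcongr
    exact monotone_deriv_cgf huniv (by gcongr)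
  have hcont : Continuous fun x ↦ (b * deriv (cgf id μ) (b * (x - ζ)))⁻¹ :=
    (continuous_const.mul ((continuous_deriv_cgf huniv).comp (by fun_prop))).inv₀
      fun x ↦ (mul_pos hb (hderiv_pos _)).ne'
  simp_rw [hH, hratio]
  exact hanti.existsUnique_add_sub_eq_zero hcont _
end

section
/- Fix additionally β > 0 and θ > 0, and define R̂(x,θ) = (ζκ + ρx − β(ρ+2κ)θ)/(ρ(ρ+κ)) and c̄ = c(ρ+κ) − (ζκ − β(ρ+2κ)θ)/ρ. Then the equation ψ'(x)(c − R̂(x,θ)) + (ρ+κ)⁻¹ψ(x) = 0 has a unique solution x̂ ∈ ℝ, and x̂ lies in the open interval (c̄, c̄ + ψ(c̄)/ψ'(c̄)). -/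
open Real MeasureTheory

/-- The parabolic cylinder integral `∫₀^∞ t ^ (a - 1) * exp (-t ^ 2 / 2 + x * t) dt`. -/
noncomputable def cylinderIntegral (a x : ℝ) : ℝ :=
  ∫ t in Set.Ioi (0 : ℝ), t ^ (a - 1) * exp (-t ^ 2 / 2 + x * t)

lemma setIntegral_Ioi_pos_of_ne {f : ℝ → ℝ} (m : ℝ) (hf : IntegrableOn f (Set.Ioi 0))
    (h0 : ∀ t, 0 < t → 0 ≤ f t) (hpos : ∀ t, 0 < t → t ≠ m → 0 < f t) :
    0 < ∫ t in Set.Ioi (0 : ℝ), f t := by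
  rw [setIntegral_pos_iff_support_of_nonneg_ae
    ((ae_restrict_iff' measurableSet_Ioi).2 (.of_forall h0)) hf]
  have hsub : Set.Ioi (max 0 m) ⊆ Function.support f ∩ Set.Ioi 0 := fun t ht =>
    ⟨(hpos t ((le_max_left 0 m).trans_lt ht) ((le_max_right 0 m).trans_lt ht).ne').ne',
      (le_max_left 0 m).trans_lt ht⟩
  exact lt_of_lt_of_le (by simp) (measure_mono hsub)

lemma integrableOn_rpow_mul_exp_gaussian {a : ℝ} (ha : 0 < a) (x : ℝ) :
    IntegrableOn (fun t : ℝ => t ^ (a - 1) * exp (-t ^ 2 / 2 + x * t)) (Set.Ioi 0) := by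
  have hdom : IntegrableOn (fun t : ℝ => exp (x ^ 2) * (t ^ (a - 1) * exp (-(1 / 4) * t ^ 2)))
      (Set.Ioi 0) :=
    (integrableOn_rpow_mul_exp_neg_mul_sq (by norm_num) (by linarith)).const_mul _
  refine hdom.mono' (by fun_prop) ((ae_restrict_iff' measurableSet_Ioi).2 (.of_forall ?_))
  intro t (ht : 0 < t)
  rw [norm_of_nonneg (by positivity), mul_left_comm, ← exp_add]
  refine mul_le_mul_of_nonneg_left (exp_le_exp.2 ?_) (by positivity)
  nlinarith [sq_nonneg (t / 2 - x)]

lemma cylinderIntegral_pos {a : ℝ} (ha : 0 < a) (x : ℝ) : 0 < cylinderIntegral a x :=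
  setIntegral_Ioi_pos_of_ne 0 (integrableOn_rpow_mul_exp_gaussian ha x)
    (fun t ht => by positivity) (fun t ht _ => by positivity)

lemma hasDerivAt_cylinderIntegral {a : ℝ} (ha : 0 < a) (x : ℝ) :
    HasDerivAt (cylinderIntegral a) (cylinderIntegral (a + 1) x) x := by
  refine (hasDerivAt_integral_of_dominated_loc_of_deriv_le
    (F := fun x t : ℝ => t ^ (a - 1) * exp (-t ^ 2 / 2 + x * t))
    (F' := fun x t : ℝ => t ^ (a + 1 - 1) * exp (-t ^ 2 / 2 + x * t))
    (bound := fun t => t ^ (a + 1 - 1) * exp (-t ^ 2 / 2 + (x + 1) * t))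
    (Metric.ball_mem_nhds x one_pos) (.of_forall fun y => by fun_prop)
    (integrableOn_rpow_mul_exp_gaussian ha x) (by fun_prop) ?_
    (integrableOn_rpow_mul_exp_gaussian (by linarith) (x + 1)) ?_).2
  · refine (ae_restrict_iff' measurableSet_Ioi).2 (.of_forall ?_)
    intro t (ht : 0 < t) y hy
    rw [norm_of_nonneg (by positivity)]
    have hyx : y ≤ x + 1 := by
      rw [Metric.mem_ball, Real.dist_eq, abs_lt] at hy
      linarith
    gcongr
  · refine (ae_restrict_iff' measurableSet_Ioi).2 (.of_forall ?_)
    intro t (ht : 0 < t) y _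
    have hexp : HasDerivAt (fun y : ℝ => -t ^ 2 / 2 + y * t) (1 * t) y :=
      ((hasDerivAt_id y).mul_const t).const_add _
    refine (hexp.exp.const_mul (t ^ (a - 1))).congr_deriv ?_
    rw [show a + 1 - 1 = (a - 1) + 1 by ring, rpow_add_one ht.ne']
    ring

/-- Log-convexity in division-free form. -/
lemma cylinderIntegral_mul_lt_mul {a : ℝ} (ha : 0 < a) {x y : ℝ} (hxy : x < y) :
    cylinderIntegral (a + 1) x * cylinderIntegral a y <
      cylinderIntegral (a + 1) y * cylinderIntegral a x := by
  have hM := cylinderIntegral_pos ha x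
  set m := cylinderIntegral (a + 1) x / cylinderIntegral a x with hm
  have hI := fun z => integrableOn_rpow_mul_exp_gaussian ha z
  have hJ := fun z => integrableOn_rpow_mul_exp_gaussian (a := a + 1) (by linarith) z
  have hInt := fun z => (hJ z).sub ((hI z).const_mul m)
  have hval : ∀ z, ∫ t in Set.Ioi (0 : ℝ), (t ^ (a + 1 - 1) * exp (-t ^ 2 / 2 + z * t) -
      m * (t ^ (a - 1) * exp (-t ^ 2 / 2 + z * t))) =
      cylinderIntegral (a + 1) z - m * cylinderIntegral a z := by
    intro z
    rw [integral_sub (hJ z) ((hI z).const_mul m), integral_const_mul]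
    rfl
  have hfac : ∀ t, 0 < t →
      (t ^ (a + 1 - 1) * exp (-t ^ 2 / 2 + y * t) -
          m * (t ^ (a - 1) * exp (-t ^ 2 / 2 + y * t))) -
        exp ((y - x) * m) * (t ^ (a + 1 - 1) * exp (-t ^ 2 / 2 + x * t) -
          m * (t ^ (a - 1) * exp (-t ^ 2 / 2 + x * t))) =
      t ^ (a - 1) * exp (-t ^ 2 / 2 + x * t) *
        ((t - m) * (exp ((y - x) * t) - exp ((y - x) * m))) := by
    intro t ht
    rw [show a + 1 - 1 = (a - 1) + 1 by ring, rpow_add_one ht.ne',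
      show -t ^ 2 / 2 + y * t = (-t ^ 2 / 2 + x * t) + (y - x) * t by ring,
      exp_add (-t ^ 2 / 2 + x * t)]
    ring
  have hsign : ∀ t, t ≠ m → 0 < (t - m) * (exp ((y - x) * t) - exp ((y - x) * m)) := by
    intro t htm
    rcases htm.lt_or_gt with h | h
    · exact mul_pos_of_neg_of_neg (sub_neg.2 h)
        (sub_neg.2 (exp_lt_exp.2 (mul_lt_mul_of_pos_left h (sub_pos.2 hxy))))
    · exact mul_pos (sub_pos.2 h)
        (sub_pos.2 (exp_lt_exp.2 (mul_lt_mul_of_pos_left h (sub_pos.2 hxy))))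
  have hpos := setIntegral_Ioi_pos_of_ne m ((hInt y).sub ((hInt x).const_mul (exp ((y - x) * m))))
    (fun t ht => by
      refine le_of_le_of_eq ?_ (hfac t ht).symm
      rcases eq_or_ne t m with rfl | h
      · simp
      · have := hsign t h
        positivity)
    (fun t ht h => by
      refine lt_of_lt_of_eq ?_ (hfac t ht).symm
      have := hsign t h
      positivity)
  have hsub := integral_sub (hInt y) ((hInt x).const_mul (exp ((y - x) * m)))
  simp only [Pi.sub_apply] at hpos hsub
  rw [hsub, integral_const_mul, hval, hval] at hpos
  have hmx : m * cylinderIntegral a x = cylinderIntegral (a + 1) x := div_mul_cancel₀ _ hM.ne'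
  rw [hmx, sub_self, mul_zero, sub_zero, sub_pos] at hpos
  calc _ = m * cylinderIntegral a y * cylinderIntegral a x := by rw [← hmx]; ring
    _ < _ := mul_lt_mul_of_pos_right hpos hM

/-- If `f, g > 0` are continuous and `f / g` is strictly decreasing, then `g x * (b - x) + f x`
has exactly one zero, which lies in `(b, b + f b / g b)`. -/
lemma existsUnique_zero_of_strictAnti_div {f g : ℝ → ℝ} (hf : Continuous f) (hg : Continuous g)
    (hf0 : ∀ x, 0 < f x) (hg0 : ∀ x, 0 < g x) (hanti : StrictAnti fun x => f x / g x) (b : ℝ) :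
    (∃! x, g x * (b - x) + f x = 0) ∧
      ∀ x, g x * (b - x) + f x = 0 → x ∈ Set.Ioo b (b + f b / g b) := by
  have hiff : ∀ x, g x * (b - x) + f x = 0 ↔ f x / g x = x - b := by
    intro x
    rw [div_eq_iff (hg0 x).ne']
    constructor <;> intro h <;> linarith
  simp only [hiff]
  have hlt : ∀ x, f x / g x = x - b → b < x := fun x hx => by
    have := div_pos (hf0 x) (hg0 x)
    linarith
  have huniq : StrictAnti fun x => f x / g x - (x - b) := fun x y hxy => by
    have := hanti hxy
    simp only at this ⊢
    linarith
  refine ⟨?_, fun x hx => ⟨hlt x hx, ?_⟩⟩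
  · have hcont : Continuous fun x => f x / g x - (x - b) :=
      (hf.div hg fun x => (hg0 x).ne').sub (by fun_prop)
    have hb := div_pos (hf0 b) (hg0 b)
    have hy : f (b + f b / g b) / g (b + f b / g b) < f b / g b :=
      hanti (lt_add_of_pos_right b hb)
    obtain ⟨x, -, hx⟩ := intermediate_value_Icc' (lt_add_of_pos_right b hb).le
      hcont.continuousOn (show (0 : ℝ) ∈ Set.Icc _ _ from ⟨by linarith, by simpa using hb.le⟩)
    refine ⟨x, sub_eq_zero.1 hx, fun y hy' => huniq.injective ?_⟩
    exact (sub_eq_zero.2 hy').trans hx.symm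
  · have : f x / g x < f b / g b := hanti (hlt x hx)
    linarith

/-- With price impact `β > 0` and maximum power `θ > 0`, the boundary-condition
equation `ψ'(x)(c − R̂(x,θ)) + (ρ+κ)⁻¹ψ(x) = 0` has a unique solution `x̂`, and
`x̂ ∈ (c̄, c̄ + ψ(c̄)/ψ'(c̄))` where `c̄ = c(ρ+κ) − (ζκ − β(ρ+2κ)θ)/ρ`. -/
theorem boundary_condition_unique_solution
    (κ σ ρ c ζ β θ : ℝ) (hκ : 0 < κ) (hσ : 0 < σ) (hρ : 0 < ρ) (hc : 0 < c)
    (hβ : 0 < β) (hθ : 0 < θ)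
    (ψ : ℝ → ℝ)
    (hψ : ∀ x : ℝ, ψ x = (Real.Gamma (ρ / κ))⁻¹ *
      ∫ t in Set.Ioi (0 : ℝ), t ^ (ρ / κ - 1) *
        Real.exp (-t ^ 2 / 2 + ((x - ζ) * Real.sqrt (2 * κ) / σ) * t))
    (Rhat : ℝ → ℝ)
    (hRhat : ∀ x : ℝ,
      Rhat x = (ζ * κ + ρ * x - β * (ρ + 2 * κ) * θ) / (ρ * (ρ + κ)))
    (cbar : ℝ)
    (hcbar : cbar = c * (ρ + κ) - (ζ * κ - β * (ρ + 2 * κ) * θ) / ρ) :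
    (∃! xhat : ℝ, deriv ψ xhat * (c - Rhat xhat) + (ρ + κ)⁻¹ * ψ xhat = 0) ∧
    (∀ xhat : ℝ, deriv ψ xhat * (c - Rhat xhat) + (ρ + κ)⁻¹ * ψ xhat = 0 →
      xhat ∈ Set.Ioo cbar (cbar + ψ cbar / deriv ψ cbar)) := by
  set a := ρ / κ with ha_def
  have ha : 0 < a := div_pos hρ hκ
  set k := √(2 * κ) / σ with hk_def
  have hk : 0 < k := by positivity
  have hG : 0 < (Gamma a)⁻¹ := inv_pos.2 (Gamma_pos_of_pos ha)
  have hψ' : ψ = fun x => (Gamma a)⁻¹ * cylinderIntegral a ((x - ζ) * k) := by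
    funext x
    rw [hψ x, hk_def, ← mul_div_assoc]
    rfl
  have haff : ∀ x, HasDerivAt (fun x : ℝ => (x - ζ) * k) k x := fun x => by
    simpa using ((hasDerivAt_id x).sub_const ζ).mul_const k
  have hderivAt : ∀ x, HasDerivAt ψ
      ((Gamma a)⁻¹ * (cylinderIntegral (a + 1) ((x - ζ) * k) * k)) x := fun x => by
    rw [hψ']
    exact ((hasDerivAt_cylinderIntegral ha _).comp x (haff x)).const_mul _
  have hderiv : deriv ψ = fun x => (Gamma a)⁻¹ * (cylinderIntegral (a + 1) ((x - ζ) * k) * k) :=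
    funext fun x => (hderivAt x).deriv
  have hcontψ : Continuous ψ :=
    continuous_iff_continuousAt.2 fun x => (hderivAt x).continuousAt
  have hcont : Continuous (cylinderIntegral (a + 1)) := continuous_iff_continuousAt.2 fun x =>
    (hasDerivAt_cylinderIntegral (by linarith) x).continuousAt
  have hM := cylinderIntegral_pos ha
  have hM' := cylinderIntegral_pos (a := a + 1) (by linarith)
  have hψ0 : ∀ x, 0 < ψ x := fun x => by
    rw [hψ']
    exact mul_pos hG (hM _)
  have hψ'0 : ∀ x, 0 < deriv ψ x := fun x => by
    rw [hderiv]
    exact mul_pos hG (mul_pos (hM' _) hk)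
  have hanti : StrictAnti fun x => ψ x / deriv ψ x := fun x y hxy => by
    have hlt := cylinderIntegral_mul_lt_mul ha
      (mul_lt_mul_of_pos_right (sub_lt_sub_right hxy ζ) hk)
    change ψ y / deriv ψ y < ψ x / deriv ψ x
    rw [div_lt_div_iff₀ (hψ'0 y) (hψ'0 x), hderiv, hψ']
    have := mul_lt_mul_of_pos_left hlt (mul_pos (mul_pos hG hG) hk)
    simp only
    linarith
  have hequiv : ∀ x, deriv ψ x * (c - Rhat x) + (ρ + κ)⁻¹ * ψ x = 0 ↔
      deriv ψ x * (cbar - x) + ψ x = 0 := fun x => by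
    have hρκ : 0 < ρ + κ := by positivity
    have hfac : deriv ψ x * (c - Rhat x) + (ρ + κ)⁻¹ * ψ x =
        (ρ + κ)⁻¹ * (deriv ψ x * (cbar - x) + ψ x) := by
      rw [hRhat, hcbar]
      field_simp
      ring
    rw [hfac, mul_eq_zero, or_iff_right (inv_pos.2 hρκ).ne']
  simp only [hequiv]
  exact existsUnique_zero_of_strictAnti_div hcontψ (by rw [hderiv]; fun_prop) hψ0 hψ'0 hanti cbar
end

section
/- Fix additionally θ > 0, a > 0 and c ∈ ℝ. Suppose A : ℝ → ℝ is twice differentiable and F : ℝ → ℝ is differentiable, and that for every y ∈ [0, θ] the smooth-fit conditions hold: (i) A'(y)ψ(F(y)) + aF(y)/(ρ+κ) + aζκ/(ρ(ρ+κ)) − c = 0 and (ii) A'(y)ψ'(F(y)) + a/(ρ+κ) = 0. Then A''(y) = 0 for every y ∈ [0, θ], i.e. A is affine on [0, θ]. -/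
open Real MeasureTheory

/-- A nonnegative function does not vanish where its derivative is nonzero. -/
theorem ne_zero_of_nonneg_of_deriv_ne_zero {f : ℝ → ℝ} {x : ℝ} (hf : ∀ z, 0 ≤ f z)
    (hx : deriv f x ≠ 0) : f x ≠ 0 := fun h =>
  hx (IsLocalMin.deriv_eq_zero (Filter.Eventually.of_forall fun z => h.le.trans (hf z)))

/-- Under the smooth-fit conditions along the free boundary, `A'' = 0` on
`[0, θ]`, i.e. `A` is affine there. -/
theorem smooth_fit_A_affine
    (κ σ ρ ζ θ a c : ℝ) (hκ : 0 < κ) (hσ : 0 < σ) (hρ : 0 < ρ)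
    (hθ : 0 < θ) (ha : 0 < a)
    (ψ : ℝ → ℝ)
    (hψ : ∀ x : ℝ, ψ x = (Real.Gamma (ρ / κ))⁻¹ *
      ∫ t in Set.Ioi (0 : ℝ), t ^ (ρ / κ - 1) *
        Real.exp (-t ^ 2 / 2 + ((x - ζ) * Real.sqrt (2 * κ) / σ) * t))
    (A F : ℝ → ℝ)
    (hA : ∀ y : ℝ, DifferentiableAt ℝ A y ∧ DifferentiableAt ℝ (deriv A) y)
    (hF : ∀ y : ℝ, DifferentiableAt ℝ F y)
    (h1 : ∀ y ∈ Set.Icc (0 : ℝ) θ,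
      deriv A y * ψ (F y) + a * F y / (ρ + κ) + a * ζ * κ / (ρ * (ρ + κ)) - c = 0)
    (h2 : ∀ y ∈ Set.Icc (0 : ℝ) θ,
      deriv A y * deriv ψ (F y) + a / (ρ + κ) = 0) :
    ∀ y ∈ Set.Icc (0 : ℝ) θ, iteratedDeriv 2 A y = 0 := by
  intro y hy
  have hψ_nonneg : ∀ x, 0 ≤ ψ x := fun x => by
    rw [hψ x]
    refine mul_nonneg (inv_nonneg.mpr (Real.Gamma_pos_of_pos (div_pos hρ hκ)).le) ?_
    exact setIntegral_nonneg measurableSet_Ioi fun t ht =>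
      mul_nonneg (Real.rpow_nonneg (le_of_lt ht) _) (Real.exp_pos _).le
  have hψ' : deriv ψ (F y) ≠ 0 := fun h => by
    have h2y := h2 y hy
    rw [h, mul_zero, zero_add] at h2y
    exact (div_pos ha (add_pos hρ hκ)).ne' h2y
  have hψF : HasDerivAt (fun z => ψ (F z)) (deriv ψ (F y) * deriv F y) y :=
    (differentiableAt_of_deriv_ne_zero hψ').hasDerivAt.comp y (hF y).hasDerivAt
  have hfit := (((((hA y).2.hasDerivAt.mul hψF).add
    (((hF y).hasDerivAt.const_mul a).div_const (ρ + κ))).add_const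
      (a * ζ * κ / (ρ * (ρ + κ)))).sub_const c).hasDerivWithinAt (s := Set.Icc 0 θ)
  have hzero : HasDerivWithinAt (fun _ : ℝ => (0 : ℝ)) 0 (Set.Icc 0 θ) y :=
    hasDerivWithinAt_const y _ 0
  have hderiv := (uniqueDiffOn_Icc hθ y hy).eq_deriv _
    (hfit.congr (fun z hz => (h1 z hz).symm) (h1 y hy).symm) hzero
  have hprod : deriv (deriv A) y * ψ (F y) = 0 := by
    linear_combination hderiv - deriv F y * h2 y hy
  rw [iteratedDeriv_succ, iteratedDeriv_one]
  exact (mul_eq_zero.mp hprod).resolve_right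
    (ne_zero_of_nonneg_of_deriv_ne_zero hψ_nonneg hψ')
end

section
/- Fix additionally θ > 0, a > 0 and c ∈ ℝ. Suppose A : ℝ → ℝ is twice differentiable and F : ℝ → ℝ is differentiable, and that for every y ∈ [0, θ] the smooth-fit conditions hold: (i) A'(y)ψ(F(y)) + aF(y)/(ρ+κ) + aζκ/(ρ(ρ+κ)) − c = 0 and (ii) A'(y)ψ'(F(y)) + a/(ρ+κ) = 0. Then for every y ∈ [0, θ] one has F(y) = c(ρ+κ)/a − ζκ/ρ + ψ(F(y))/ψ'(F(y)), and F is constant on [0, θ]. -/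
open Real MeasureTheory

theorem MeasureTheory.setIntegral_pos_of_forall_pos {X : Type*} [MeasurableSpace X]
    {μ : Measure X} {s : Set X} {f : X → ℝ} (hs : MeasurableSet s) (hμ : μ s ≠ 0)
    (hf : IntegrableOn f s μ) (hpos : ∀ x ∈ s, 0 < f x) : 0 < ∫ x in s, f x ∂μ := by
  rw [setIntegral_pos_iff_support_of_nonneg_ae
    ((ae_restrict_iff' hs).2 (.of_forall fun x hx => (hpos x hx).le)) hf,
    Set.inter_eq_right.2 fun x hx => Function.mem_support.2 (hpos x hx).ne']
  exact pos_iff_ne_zero.2 hμ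

theorem StrictConvexOn.eq_of_hasDerivAt {S : Set ℝ} {f : ℝ → ℝ} {x y f' : ℝ}
    (hf : StrictConvexOn ℝ S f) (hx : x ∈ S) (hy : y ∈ S)
    (hfx : HasDerivAt f f' x) (hfy : HasDerivAt f f' y) : x = y := by
  rcases lt_trichotomy x y with h | h | h
  · exact absurd ((hf.lt_slope_of_hasDerivAt hx hy h hfx).trans
      (hf.slope_lt_of_hasDerivAt hx hy h hfy)) (lt_irrefl _)
  · exact h
  · exact absurd ((hf.lt_slope_of_hasDerivAt hy hx h hfy).trans
      (hf.slope_lt_of_hasDerivAt hy hx h hfx)) (lt_irrefl _)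

theorem integrableOn_rpow_mul_exp_neg_sq_div_two_add_mul {s : ℝ} (hs : -1 < s) (b : ℝ) :
    IntegrableOn (fun t : ℝ => t ^ s * exp (-t ^ 2 / 2 + b * t)) (Set.Ioi 0) := by
  refine ((integrableOn_rpow_mul_exp_neg_mul_sq (b := 1 / 4) (by norm_num) hs).const_mul
    (exp (b ^ 2))).mono' (by fun_prop) ?_
  refine (ae_restrict_iff' measurableSet_Ioi).2 (.of_forall fun t (ht : 0 < t) => ?_)
  have hexp : exp (-t ^ 2 / 2 + b * t) ≤ exp (b ^ 2) * exp (-(1 / 4) * t ^ 2) := by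
    rw [← exp_add]
    exact exp_le_exp.2 (by nlinarith [sq_nonneg (t / 2 - b)])
  rw [norm_of_nonneg (by positivity), mul_left_comm]
  gcongr

theorem integral_rpow_mul_exp_neg_sq_div_two_add_mul_pos {s : ℝ} (hs : -1 < s) (b : ℝ) :
    0 < ∫ t in Set.Ioi (0 : ℝ), t ^ s * exp (-t ^ 2 / 2 + b * t) :=
  setIntegral_pos_of_forall_pos measurableSet_Ioi (by simp)
    (integrableOn_rpow_mul_exp_neg_sq_div_two_add_mul hs b)
    fun _ ht => mul_pos (rpow_pos_of_pos ht _) (exp_pos _)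

theorem strictConvexOn_integral_rpow_mul_exp_neg_sq_div_two_add_mul {s : ℝ} (hs : -1 < s) :
    StrictConvexOn ℝ Set.univ
      fun b : ℝ => ∫ t in Set.Ioi (0 : ℝ), t ^ s * exp (-t ^ 2 / 2 + b * t) := by
  refine ⟨convex_univ, fun x _ y _ hxy p q hp hq hpq => ?_⟩
  have hint := integrableOn_rpow_mul_exp_neg_sq_div_two_add_mul hs
  have hadd : IntegrableOn (fun t : ℝ => p * (t ^ s * exp (-t ^ 2 / 2 + x * t)) +
      q * (t ^ s * exp (-t ^ 2 / 2 + y * t))) (Set.Ioi 0) :=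
    ((hint x).const_mul p).add ((hint y).const_mul q)
  simp only [smul_eq_mul]
  rw [← sub_pos, ← integral_const_mul, ← integral_const_mul,
    ← integral_add ((hint x).const_mul p) ((hint y).const_mul q),
    ← integral_sub hadd (hint _)]
  refine setIntegral_pos_of_forall_pos measurableSet_Ioi (by simp)
    (hadd.sub (hint _)) fun t (ht : 0 < t) => ?_
  have hne : -t ^ 2 / 2 + x * t ≠ -t ^ 2 / 2 + y * t := fun h =>
    hxy (mul_right_cancel₀ ht.ne' (add_left_cancel h))
  have hexp := strictConvexOn_exp.2 (Set.mem_univ _) (Set.mem_univ _) hne hp hq hpq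
  simp only [smul_eq_mul] at hexp
  have harg : p * (-t ^ 2 / 2 + x * t) + q * (-t ^ 2 / 2 + y * t)
      = -t ^ 2 / 2 + (p * x + q * y) * t := by
    linear_combination (-t ^ 2 / 2) * hpq
  rw [harg] at hexp
  have := mul_lt_mul_of_pos_left hexp (rpow_pos_of_pos ht s)
  linarith

/-- Under the smooth-fit conditions, the free boundary satisfies
`F(y) = c(ρ+κ)/a − ζκ/ρ + ψ(F(y))/ψ'(F(y))` and is constant on `[0, θ]`. -/
theorem smooth_fit_F_constant
    (κ σ ρ ζ θ a c : ℝ) (hκ : 0 < κ) (hσ : 0 < σ) (hρ : 0 < ρ)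
    (hθ : 0 < θ) (ha : 0 < a)
    (ψ : ℝ → ℝ)
    (hψ : ∀ x : ℝ, ψ x = (Real.Gamma (ρ / κ))⁻¹ *
      ∫ t in Set.Ioi (0 : ℝ), t ^ (ρ / κ - 1) *
        Real.exp (-t ^ 2 / 2 + ((x - ζ) * Real.sqrt (2 * κ) / σ) * t))
    (A F : ℝ → ℝ)
    (hA : ∀ y : ℝ, DifferentiableAt ℝ A y ∧ DifferentiableAt ℝ (deriv A) y)
    (hF : ∀ y : ℝ, DifferentiableAt ℝ F y)
    (h1 : ∀ y ∈ Set.Icc (0 : ℝ) θ,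
      deriv A y * ψ (F y) + a * F y / (ρ + κ) + a * ζ * κ / (ρ * (ρ + κ)) - c = 0)
    (h2 : ∀ y ∈ Set.Icc (0 : ℝ) θ,
      deriv A y * deriv ψ (F y) + a / (ρ + κ) = 0) :
    (∀ y ∈ Set.Icc (0 : ℝ) θ,
      F y = c * (ρ + κ) / a - ζ * κ / ρ + ψ (F y) / deriv ψ (F y)) ∧
    (∀ y₁ ∈ Set.Icc (0 : ℝ) θ, ∀ y₂ ∈ Set.Icc (0 : ℝ) θ, F y₁ = F y₂) := by
  have hs : -1 < ρ / κ - 1 := by linarith [div_pos hρ hκ]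
  have hΓ : 0 < (Real.Gamma (ρ / κ))⁻¹ := inv_pos.2 (Gamma_pos_of_pos (div_pos hρ hκ))
  have hψ_pos : ∀ x, 0 < ψ x := fun x => by
    rw [hψ]
    exact mul_pos hΓ (integral_rpow_mul_exp_neg_sq_div_two_add_mul_pos hs _)
  have hk : 0 < √(2 * κ) := sqrt_pos.2 (by positivity)
  have hψ_conv : StrictConvexOn ℝ Set.univ ψ := by
    refine ⟨convex_univ, fun x _ y _ hxy p q hp hq hpq => ?_⟩
    have hne : (x - ζ) * √(2 * κ) / σ ≠ (y - ζ) * √(2 * κ) / σ := fun h => hxy <| by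
      rwa [div_left_inj' hσ.ne', mul_left_inj' hk.ne', sub_left_inj] at h
    have hlt := (strictConvexOn_integral_rpow_mul_exp_neg_sq_div_two_add_mul hs).2
      (Set.mem_univ _) (Set.mem_univ _) hne hp hq hpq
    have harg : p * ((x - ζ) * √(2 * κ) / σ) + q * ((y - ζ) * √(2 * κ) / σ)
        = (p * x + q * y - ζ) * √(2 * κ) / σ := by
      linear_combination (-ζ * √(2 * κ) / σ) * hpq
    simp only [smul_eq_mul] at hlt ⊢
    rw [harg] at hlt
    rw [hψ, hψ x, hψ y]
    linarith [mul_lt_mul_of_pos_left hlt hΓ]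
  have hρκ : ρ + κ ≠ 0 := by positivity
  have hψ'_ne : ∀ y ∈ Set.Icc (0 : ℝ) θ, deriv ψ (F y) ≠ 0 := fun y hy h => by
    have := h2 y hy
    rw [h, mul_zero, zero_add] at this
    exact (div_ne_zero ha.ne' hρκ) this
  have hψ_diff : ∀ y ∈ Set.Icc (0 : ℝ) θ, HasDerivAt ψ (deriv ψ (F y)) (F y) := fun y hy =>
    (differentiableAt_of_deriv_ne_zero (hψ'_ne y hy)).hasDerivAt
  refine ⟨fun y hy => ?_, ?_⟩
  · have hne := hψ'_ne y hy
    have e1 := h1 y hy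
    have e2 := h2 y hy
    have hA' : deriv A y = -(a / (ρ + κ)) / deriv ψ (F y) := by
      rw [eq_div_iff hne]; linarith
    rw [hA'] at e1
    field_simp at e1 ⊢
    linarith
  have hA'' : ∀ y ∈ Set.Icc (0 : ℝ) θ, deriv (deriv A) y = 0 := fun y hy => by
    have hd := ((((hA y).2.hasDerivAt.mul
      ((hψ_diff y hy).comp y (hF y).hasDerivAt)).add
      (((hF y).hasDerivAt.const_mul a).div_const (ρ + κ))).add_const
      (a * ζ * κ / (ρ * (ρ + κ)))).sub_const c
    have hzero := (hasDerivWithinAt_const y (Set.Icc 0 θ) (0 : ℝ)).congr_of_mem h1 hy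
    have heq := (uniqueDiffOn_Icc hθ y hy).eq_deriv _ hd.hasDerivWithinAt hzero
    have hprod : deriv (deriv A) y * ψ (F y) = 0 := by
      simp only [Function.comp_apply] at heq
      linear_combination heq - deriv F y * h2 y hy
    exact (mul_eq_zero.1 hprod).resolve_right (hψ_pos _).ne'
  have hA'_const : ∀ y ∈ Set.Icc (0 : ℝ) θ, deriv A y = deriv A 0 :=
    constant_of_has_deriv_right_zero (fun y _ => (hA y).2.continuousAt.continuousWithinAt)
      fun y hy => by
        have := (hA y).2.hasDerivAt
        rw [hA'' y (Set.Ico_subset_Icc_self hy)] at this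
        exact this.hasDerivWithinAt
  intro y₁ hy₁ y₂ hy₂
  have e₁ := h2 y₁ hy₁
  have e₂ := h2 y₂ hy₂
  rw [hA'_const _ hy₁] at e₁
  rw [hA'_const _ hy₂] at e₂
  have hA'_ne : deriv A 0 ≠ 0 := fun h => by
    rw [h, zero_mul, zero_add] at e₁
    exact (div_ne_zero ha.ne' hρκ) e₁
  have hψ'_eq : deriv ψ (F y₁) = deriv ψ (F y₂) :=
    mul_left_cancel₀ hA'_ne (by linarith)
  exact hψ_conv.eq_of_hasDerivAt (Set.mem_univ _) (Set.mem_univ _) (hψ_diff y₁ hy₁)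
    (hψ'_eq ▸ hψ_diff y₂ hy₂)
end

section
/- Let x̄ be the unique zero of H and define g : ℝ → ℝ by g(x) = −ψ(x)/((ρ+κ)ψ'(x̄)) + x/(ρ+κ) + ζκ/(ρ(ρ+κ)) − c. Then g(x̄) = 0 and g(x) < 0 for every x ≠ x̄; in particular, in the waiting region {x < x̄} the candidate value function w(x,y) = A(y)ψ(x) + R(x,y), with A(y) = (θ−y)/((ρ+κ)ψ'(x̄)) and R(x,y) = xy/(ρ+κ) + ζκy/(ρ(ρ+κ)), satisfies the strict inequality ∂w/∂y − c < 0. -/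
open Real MeasureTheory

/-- Integrals `∫₀^∞ t^q exp(-t²/2 + a t) dt`. -/
noncomputable def gaussMoment (q a : ℝ) : ℝ :=
  ∫ t in Set.Ioi (0 : ℝ), t ^ q * Real.exp (-t ^ 2 / 2 + a * t)

lemma integrableOn_gaussMoment {q : ℝ} (hq : -1 < q) (a : ℝ) :
    IntegrableOn (fun t : ℝ => t ^ q * Real.exp (-t ^ 2 / 2 + a * t)) (Set.Ioi 0) := by
  have h := (integrableOn_rpow_mul_exp_neg_mul_sq (b := 1 / 4) (by norm_num) hq).const_mul
    (Real.exp (a ^ 2))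
  refine h.mono' (by fun_prop) ?_
  refine (ae_restrict_iff' measurableSet_Ioi).2 (.of_forall fun t ht => ?_)
  have ht' : 0 < t := ht
  rw [Real.norm_of_nonneg (by positivity), mul_left_comm, ← Real.exp_add]
  refine mul_le_mul_of_nonneg_left (Real.exp_le_exp.2 ?_) (by positivity)
  nlinarith [sq_nonneg (t / 2 - a)]

lemma gaussMoment_pos {q : ℝ} (hq : -1 < q) (a : ℝ) : 0 < gaussMoment q a := by
  refine (setIntegral_pos_iff_support_of_nonneg_ae ?_ (integrableOn_gaussMoment hq a)).2 ?_
  · refine (ae_restrict_iff' measurableSet_Ioi).2 (.of_forall fun t ht => ?_)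
    have ht' : 0 < t := ht
    simp only [Pi.zero_apply]
    positivity
  · have hsub : Set.Ioi (0 : ℝ) ⊆
        (Function.support fun t : ℝ => t ^ q * Real.exp (-t ^ 2 / 2 + a * t)) ∩ Set.Ioi 0 :=
      fun t ht => ⟨(mul_pos (Real.rpow_pos_of_pos ht q) (Real.exp_pos _)).ne', ht⟩
    exact lt_of_lt_of_le (by simp) (measure_mono hsub)

lemma hasDerivAt_gaussMoment {q : ℝ} (hq : -1 < q) (a : ℝ) :
    HasDerivAt (gaussMoment q) (gaussMoment (q + 1) a) a := by
  refine (hasDerivAt_integral_of_dominated_loc_of_deriv_le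
    (F' := fun x t => t ^ (q + 1) * Real.exp (-t ^ 2 / 2 + x * t))
    (bound := fun t => t ^ (q + 1) * Real.exp (-t ^ 2 / 2 + (a + 1) * t))
    (Metric.ball_mem_nhds a one_pos)
    (.of_forall fun x => (integrableOn_gaussMoment hq x).aestronglyMeasurable)
    (integrableOn_gaussMoment hq a) (by fun_prop) ?_
    (integrableOn_gaussMoment (by linarith) (a + 1)) ?_).2
  · refine (ae_restrict_iff' measurableSet_Ioi).2 (.of_forall fun t ht x hx => ?_)
    have ht' : 0 < t := ht
    rw [Real.norm_of_nonneg (by positivity)]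
    rw [Metric.mem_ball, Real.dist_eq, abs_lt] at hx
    gcongr
    linarith
  · refine (ae_restrict_iff' measurableSet_Ioi).2 (.of_forall fun t ht x _ => ?_)
    have h := ((((hasDerivAt_id x).mul_const t).const_add (-t ^ 2 / 2)).exp).const_mul (t ^ q)
    refine h.congr_deriv ?_
    rw [Real.rpow_add_one (ne_of_gt ht)]
    simp only [id]
    ring

lemma strictConvexOn_gaussMoment {q : ℝ} (hq : -1 < q) :
    StrictConvexOn ℝ Set.univ (gaussMoment q) := by
  have hd : deriv (gaussMoment q) = gaussMoment (q + 1) :=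
    funext fun a => (hasDerivAt_gaussMoment hq a).deriv
  refine strictConvexOn_univ_of_deriv2_pos
    (continuous_iff_continuousAt.2 fun a => (hasDerivAt_gaussMoment hq a).continuousAt) fun a => ?_
  rw [Function.iterate_succ_apply, Function.iterate_one, hd,
    (hasDerivAt_gaussMoment (by linarith) a).deriv]
  exact gaussMoment_pos (by linarith) a

/-- A strictly convex function lies strictly above its tangent lines. -/
lemma StrictConvexOn.tangent_lt {f : ℝ → ℝ} {f' a b : ℝ} (hf : StrictConvexOn ℝ Set.univ f)
    (h : HasDerivAt f f' a) (hab : b ≠ a) : f a + f' * (b - a) < f b := by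
  rcases hab.lt_or_gt with hlt | hlt
  · have := hf.slope_lt_of_hasDerivAt (Set.mem_univ b) (Set.mem_univ a) hlt h
    rw [slope_def_field, div_lt_iff₀ (by linarith)] at this
    linarith
  · have := hf.lt_slope_of_hasDerivAt (Set.mem_univ a) (Set.mem_univ b) hlt h
    rw [slope_def_field, lt_div_iff₀ (by linarith)] at this
    linarith

/-- With `x̄` the unique zero of `H` and
`g(x) = −ψ(x)/((ρ+κ)ψ'(x̄)) + x/(ρ+κ) + ζκ/(ρ(ρ+κ)) − c`, one has `g(x̄) = 0` and
`g(x) < 0` for `x ≠ x̄`; in particular in the waiting region `{x < x̄}` the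
candidate value function satisfies `∂w/∂y − c < 0`. -/
theorem g_negative_off_boundary
    (κ σ ρ c ζ θ : ℝ) (hκ : 0 < κ) (hσ : 0 < σ) (hρ : 0 < ρ) (hc : 0 < c)
    (hθ : 0 < θ)
    (ψ : ℝ → ℝ)
    (hψ : ∀ x : ℝ, ψ x = (Real.Gamma (ρ / κ))⁻¹ *
      ∫ t in Set.Ioi (0 : ℝ), t ^ (ρ / κ - 1) *
        Real.exp (-t ^ 2 / 2 + ((x - ζ) * Real.sqrt (2 * κ) / σ) * t))
    (H : ℝ → ℝ)
    (hH : ∀ x : ℝ, H x = c * (ρ + κ) - ζ * κ / ρ + ψ x / deriv ψ x - x)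
    (xbar : ℝ) (hxbar : H xbar = 0) (hxbaru : ∀ x : ℝ, H x = 0 → x = xbar)
    (g : ℝ → ℝ)
    (hg : ∀ x : ℝ, g x = -ψ x / ((ρ + κ) * deriv ψ xbar)
      + x / (ρ + κ) + ζ * κ / (ρ * (ρ + κ)) - c)
    (A : ℝ → ℝ) (hA : ∀ y : ℝ, A y = (θ - y) / ((ρ + κ) * deriv ψ xbar))
    (R : ℝ → ℝ → ℝ)
    (hR : ∀ x y : ℝ, R x y = x * y / (ρ + κ) + ζ * κ * y / (ρ * (ρ + κ))) :
    g xbar = 0 ∧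
    (∀ x : ℝ, x ≠ xbar → g x < 0) ∧
    (∀ x : ℝ, x < xbar → ∀ y : ℝ,
      deriv (fun y' : ℝ => A y' * ψ x + R x y') y - c < 0) := by
  have hq : -1 < ρ / κ - 1 := by linarith [div_pos hρ hκ]
  set m := Real.sqrt (2 * κ) / σ with hm
  have hm0 : 0 < m := by positivity
  have hK : 0 < (Real.Gamma (ρ / κ))⁻¹ := inv_pos.2 (Real.Gamma_pos_of_pos (by positivity))
  set K := (Real.Gamma (ρ / κ))⁻¹
  have hψK : ψ = fun x => K * gaussMoment (ρ / κ - 1) ((x - ζ) * m) := by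
    funext x
    simp only [hψ x, gaussMoment, hm, mul_div_assoc]
  have hd : HasDerivAt ψ (K * (gaussMoment (ρ / κ - 1 + 1) ((xbar - ζ) * m) * m)) xbar := by
    rw [hψK]
    have hlin : HasDerivAt (fun x : ℝ => (x - ζ) * m) m xbar := by
      simpa using ((hasDerivAt_id xbar).sub_const ζ).mul_const m
    exact ((hasDerivAt_gaussMoment hq _).comp xbar hlin).const_mul K
  have hd0 : 0 < deriv ψ xbar := by
    rw [hd.deriv]
    have := gaussMoment_pos (q := ρ / κ - 1 + 1) (by linarith) ((xbar - ζ) * m)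
    positivity
  have htan : ∀ x, x ≠ xbar → ψ xbar + deriv ψ xbar * (x - xbar) < ψ x := by
    intro x hx
    have h := (strictConvexOn_gaussMoment hq).tangent_lt
      (hasDerivAt_gaussMoment hq ((xbar - ζ) * m)) (b := (x - ζ) * m)
      (fun h => hx (by linarith [mul_right_cancel₀ hm0.ne' h]))
    rw [hd.deriv, hψK]
    have h' := mul_lt_mul_of_pos_left h hK
    refine lt_of_eq_of_lt ?_ h'
    ring
  have hs : 0 < ρ + κ := by linarith
  rw [hH] at hxbar
  set D := deriv ψ xbar
  have hgx : ∀ x, g x = (D * (x - xbar) + ψ xbar - ψ x) / ((ρ + κ) * D) := by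
    intro x
    have hc' : c = (ζ * κ / ρ - ψ xbar / D + xbar) / (ρ + κ) := by
      rw [eq_div_iff hs.ne']; linarith
    rw [hg, hc']
    field_simp
    ring
  have hneg : ∀ x, x ≠ xbar → g x < 0 := by
    intro x hx
    rw [hgx]
    exact div_neg_of_neg_of_pos (by linarith [htan x hx]) (by positivity)
  refine ⟨by simp [hgx], hneg, fun x hx y => ?_⟩
  have hw : HasDerivAt (fun y' : ℝ => A y' * ψ x + R x y') (g x + c) y := by
    have hlin : (fun y' : ℝ => A y' * ψ x + R x y') =
        fun y' => θ * ψ x / ((ρ + κ) * D) + y' * (g x + c) := by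
      funext y'
      rw [hA, hR, hg]
      ring
    rw [hlin]
    simpa using ((hasDerivAt_id y).mul_const (g x + c)).const_add (θ * ψ x / ((ρ + κ) * D))
  rw [hw.deriv]
  linarith [hneg x hx.ne]
end
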